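/- arXiv:2412.11689 — 4 statements merged into one kernel-verified Lean document; each statement's English description precedes it below -/
import Mathlib

section
/- Let X_1, X_2, ... be a sequence of data matrices in ℝ^{n×d} (minibatches), W_1 ∈ ℝ^{d×h} an initial weight matrix, γ ∈ ℝ a step size, and G_1, G_2, ... a sequence of maps G_k : ℝ^{n×h} → ℝ^{n×h} (the server-side gradients, which depend only on the transmitted activations). Define the gradient-descent iterates W_{k+1} = W_k − γ · X_kᵀ · G_k(X_k W_k) and activations H_k = X_k W_k. Let U ∈ ℝ^{d×d} be an orthogonal matrix (Uᵀ U = U Uᵀ = I) and define the transformed protocol with data X̃_k = X_k U, initialization W̃_1 = Uᵀ W_1, iterates W̃_{k+1} = W̃_k − γ · X̃_kᵀ · G_k(X̃_k W̃_k) and activations H̃_k = X̃_k W̃_k. Then for every k ≥ 1, W̃_k = Uᵀ W_k and H̃_k = H_k; i.e., the transformed protocol transmits identical activations to the server at every step. -/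
open Matrix

/-- In two-party Split Learning with a one-layer linear client model,
if the client data and weight initialization are transformed by an orthogonal matrix
`U` (as `X̃ₖ = Xₖ U`, `W̃₁ = Uᵀ W₁`), then the (S)GD iterates satisfy `W̃ₖ = Uᵀ Wₖ` and the
transmitted activations `H̃ₖ = X̃ₖ W̃ₖ` coincide with `Hₖ = Xₖ Wₖ` at every step. -/
theorem split_learning_orthogonal_invariance
    (n d h : ℕ)
    (X : ℕ → Matrix (Fin n) (Fin d) ℝ)
    (G : ℕ → Matrix (Fin n) (Fin h) ℝ → Matrix (Fin n) (Fin h) ℝ)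
    (γ : ℝ)
    (U : Matrix (Fin d) (Fin d) ℝ)
    (hU₁ : Uᵀ * U = 1) (hU₂ : U * Uᵀ = 1)
    (W Wt : ℕ → Matrix (Fin d) (Fin h) ℝ)
    -- original protocol: `W (k+1) = W k − γ Xₖᵀ Gₖ(Xₖ Wₖ)`
    (hW : ∀ k, 1 ≤ k → W (k + 1) = W k - γ • ((X k)ᵀ * G k (X k * W k)))
    -- transformed protocol on data `X̃ₖ = Xₖ U` with initialization `W̃₁ = Uᵀ W₁`
    (hWt1 : Wt 1 = Uᵀ * W 1)
    (hWt : ∀ k, 1 ≤ k → Wt (k + 1) = Wt k - γ • ((X k * U)ᵀ * G k ((X k * U) * Wt k))) :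
    ∀ k, 1 ≤ k → Wt k = Uᵀ * W k ∧ (X k * U) * Wt k = X k * W k := by
  have activation_eq : ∀ k, Wt k = Uᵀ * W k → (X k * U) * Wt k = X k * W k := by
    intro k hk
    rw [hk, Matrix.mul_assoc, ← Matrix.mul_assoc U, hU₂, Matrix.one_mul]
  have weights_eq : ∀ k, 1 ≤ k → Wt k = Uᵀ * W k := by
    intro k hk
    induction k, hk using Nat.le_induction with
    | base => exact hWt1
    | succ k hk ih =>
      rw [hWt k hk, activation_eq k ih, ih, hW k hk, Matrix.mul_sub, Matrix.mul_smul,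
        Matrix.transpose_mul, Matrix.mul_assoc]
  exact fun k hk => ⟨weights_eq k hk, activation_eq k (weights_eq k hk)⟩
end

section
/- Let X_1, X_2, ... be a sequence of data matrices in ℝ^{n×d}, W_1 ∈ ℝ^{d×h}, γ ∈ ℝ, and G_1, G_2, ... maps G_k : ℝ^{n×h} → ℝ^{n×h}. Define W_{k+1} = W_k − γ · X_kᵀ · G_k(X_k W_k) and H_k = X_k W_k. Let U ∈ ℝ^{d×m} be semi-orthogonal in the sense that U Uᵀ = I_d, and define X̃_k = X_k U ∈ ℝ^{n×m}, W̃_1 = Uᵀ W_1 ∈ ℝ^{m×h}, W̃_{k+1} = W̃_k − γ · X̃_kᵀ · G_k(X̃_k W̃_k) and H̃_k = X̃_k W̃_k. Then for every k ≥ 1, W̃_k = Uᵀ W_k and H̃_k = H_k. -/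
open Matrix

/-- Semi-orthogonal version of the Split Learning invariance: if
`U ∈ ℝ^{d×m}` satisfies `U Uᵀ = I_d`, then transforming the data as `X̃ₖ = Xₖ U` and the
initialization as `W̃₁ = Uᵀ W₁` gives iterates `W̃ₖ = Uᵀ Wₖ` and identical transmitted
activations `H̃ₖ = X̃ₖ W̃ₖ = Xₖ Wₖ = Hₖ` at every step. -/
theorem split_learning_semiorthogonal_invariance
    (n d m h : ℕ)
    (X : ℕ → Matrix (Fin n) (Fin d) ℝ)
    (G : ℕ → Matrix (Fin n) (Fin h) ℝ → Matrix (Fin n) (Fin h) ℝ)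
    (γ : ℝ)
    (U : Matrix (Fin d) (Fin m) ℝ)
    (hU : U * Uᵀ = 1)
    (W : ℕ → Matrix (Fin d) (Fin h) ℝ)
    (Wt : ℕ → Matrix (Fin m) (Fin h) ℝ)
    -- original protocol: `W (k+1) = W k − γ Xₖᵀ Gₖ(Xₖ Wₖ)`
    (hW : ∀ k, 1 ≤ k → W (k + 1) = W k - γ • ((X k)ᵀ * G k (X k * W k)))
    -- transformed protocol on data `X̃ₖ = Xₖ U` with initialization `W̃₁ = Uᵀ W₁`
    (hWt1 : Wt 1 = Uᵀ * W 1)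
    (hWt : ∀ k, 1 ≤ k → Wt (k + 1) = Wt k - γ • ((X k * U)ᵀ * G k ((X k * U) * Wt k))) :
    ∀ k, 1 ≤ k → Wt k = Uᵀ * W k ∧ (X k * U) * Wt k = X k * W k := by
  have activations_eq (k : ℕ) (hk : Wt k = Uᵀ * W k) : (X k * U) * Wt k = X k * W k := by
    rw [hk, Matrix.mul_assoc, ← Matrix.mul_assoc U, hU, Matrix.one_mul]
  have weights_eq : ∀ k, 1 ≤ k → Wt k = Uᵀ * W k := by
    intro k hk
    induction k, hk using Nat.le_induction with
    | base => exact hWt1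
    | succ k hk ih =>
      rw [hWt k hk, activations_eq k ih, hW k hk, ih, Matrix.transpose_mul, Matrix.mul_sub,
        Matrix.mul_smul, Matrix.mul_assoc]
  exact fun k hk => ⟨weights_eq k hk, activations_eq k (weights_eq k hk)⟩
end

section
/- Let X ∈ ℝ^{n×d}, W_1 ∈ ℝ^{d×h}, B_1 ∈ ℝ^{n×h}, γ ∈ ℝ, and let G^{fake}_1, G^{fake}_2, ... ∈ ℝ^{n×h} be arbitrary matrices. Define W_{k+1} = W_k − γ · Xᵀ · G^{fake}_k, B_{k+1} = B_k − γ · G^{fake}_k, and H_k = X W_k + B_k. Then for every k ≥ 1, H_{k+1} = X W_1 + B_1 − γ · (I + X Xᵀ) · (Σ_{i=1}^{k} G^{fake}_i). Consequently, for orthogonal U, V ∈ ℝ^{d×d}, the protocols run with data X U and with data (X V)(Vᵀ U) (each with initialization W_1, B_1) transmit identical activations at every step, so the malicious server can reconstruct X only up to an arbitrary orthogonal transformation. -/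
open Matrix Finset

/-- A sequence whose successive differences from index `1` on are `-g k` is its initial value
minus the partial sums of `g`. -/
lemma eq_sub_sum_Icc_of_succ_eq_sub {A : Type*} [AddCommGroup A] {u g : ℕ → A}
    (hu : ∀ k, 1 ≤ k → u (k + 1) = u k - g k) (k : ℕ) :
    u (k + 1) = u 1 - ∑ i ∈ Icc 1 k, g i := by
  induction k with
  | zero => simp
  | succ k ih =>
    rw [hu (k + 1) (Nat.le_add_left 1 k), ih, sum_Icc_succ_top (Nat.le_add_left 1 k), sub_sub]

/-- Fake-gradient Split Learning with a one-layer linear client model with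
bias: the transmitted activations unroll as
`H_{k+1} = X W₁ + B₁ − γ (I + X Xᵀ)(Σ_{i=1}^k Gᶠᵃᵏᵉᵢ)`; consequently for orthogonal `U, V`
the protocols run on data `X U` and on data `(X V)(Vᵀ U)` (same initialization `W₁, B₁`)
transmit identical activations at every step, so the server can reconstruct `X` only up to
an arbitrary orthogonal transformation. -/
theorem fake_gradient_with_bias
    (n d h : ℕ)
    (X : Matrix (Fin n) (Fin d) ℝ)
    (W₁ : Matrix (Fin d) (Fin h) ℝ) (B₁ : Matrix (Fin n) (Fin h) ℝ)
    (γ : ℝ)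
    (Gfake : ℕ → Matrix (Fin n) (Fin h) ℝ)
    -- the protocol on data `X`
    (W : ℕ → Matrix (Fin d) (Fin h) ℝ) (B H : ℕ → Matrix (Fin n) (Fin h) ℝ)
    (hW1 : W 1 = W₁) (hB1 : B 1 = B₁)
    (hW : ∀ k, 1 ≤ k → W (k + 1) = W k - γ • (Xᵀ * Gfake k))
    (hB : ∀ k, 1 ≤ k → B (k + 1) = B k - γ • Gfake k)
    (hH : ∀ k, 1 ≤ k → H k = X * W k + B k)
    (U V : Matrix (Fin d) (Fin d) ℝ)
    (hU₁ : Uᵀ * U = 1) (hU₂ : U * Uᵀ = 1)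
    (hV₁ : Vᵀ * V = 1) (hV₂ : V * Vᵀ = 1)
    -- the protocol on data `X U`
    (WU : ℕ → Matrix (Fin d) (Fin h) ℝ) (BU HU : ℕ → Matrix (Fin n) (Fin h) ℝ)
    (hWU1 : WU 1 = W₁) (hBU1 : BU 1 = B₁)
    (hWU : ∀ k, 1 ≤ k → WU (k + 1) = WU k - γ • ((X * U)ᵀ * Gfake k))
    (hBU : ∀ k, 1 ≤ k → BU (k + 1) = BU k - γ • Gfake k)
    (hHU : ∀ k, 1 ≤ k → HU k = (X * U) * WU k + BU k)
    -- the protocol on data `(X V)(Vᵀ U)`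
    (WV : ℕ → Matrix (Fin d) (Fin h) ℝ) (BV HV : ℕ → Matrix (Fin n) (Fin h) ℝ)
    (hWV1 : WV 1 = W₁) (hBV1 : BV 1 = B₁)
    (hWV : ∀ k, 1 ≤ k → WV (k + 1) = WV k - γ • (((X * V) * (Vᵀ * U))ᵀ * Gfake k))
    (hBV : ∀ k, 1 ≤ k → BV (k + 1) = BV k - γ • Gfake k)
    (hHV : ∀ k, 1 ≤ k → HV k = ((X * V) * (Vᵀ * U)) * WV k + BV k) :
    (∀ k, 1 ≤ k →
      H (k + 1) = X * W₁ + B₁ - γ • ((1 + X * Xᵀ) * ∑ i ∈ Icc 1 k, Gfake i)) ∧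
    (∀ k, 1 ≤ k → HU k = HV k) := by
  constructor
  · intro k _
    rw [hH (k + 1) (Nat.le_add_left 1 k), eq_sub_sum_Icc_of_succ_eq_sub hW,
      eq_sub_sum_Icc_of_succ_eq_sub hB, hW1, hB1, ← smul_sum, ← smul_sum, ← Matrix.mul_sum,
      Matrix.mul_sub, Matrix.mul_smul, Matrix.add_mul, Matrix.one_mul, Matrix.mul_assoc, smul_add]
    abel
  · have hX : (X * V) * (Vᵀ * U) = X * U := by
      rw [Matrix.mul_assoc, ← Matrix.mul_assoc V, hV₂, Matrix.one_mul]
    simp only [hX] at hWV hHV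
    rintro (_ | k) hk
    · omega
    · rw [hHU _ hk, hHV _ hk, eq_sub_sum_Icc_of_succ_eq_sub hWU,
        eq_sub_sum_Icc_of_succ_eq_sub hBU, eq_sub_sum_Icc_of_succ_eq_sub hWV,
        eq_sub_sum_Icc_of_succ_eq_sub hBV, hWU1, hBU1, hWV1, hBV1]
end

section
/- Let ℒ : ℝ^p → ℝ be differentiable with L-Lipschitz gradient (‖∇ℒ(x) − ∇ℒ(y)‖ ≤ L ‖x − y‖ for all x, y, Euclidean norm). Let D ∈ ℝ^{p×p} be a diagonal matrix with every diagonal entry at least α > 0 (so α I ≼ D and D is invertible), let γ > 0, let m ∈ ℝ^p, and set W' = W − γ D^{−1} m. Then ℒ(W') ≤ ℒ(W) + (γ / (2α)) ‖∇ℒ(W) − m‖² − (1/(2γ) − L/(2α)) ‖W' − W‖²_D − (γ/2) ‖∇ℒ(W)‖²_{D^{−1}}, where for a positive-definite matrix M the weighted squared norm is ‖v‖²_M = ⟨v, M v⟩. -/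
/-- The quadratic upper bound for a function with `L`-Lipschitz gradient. -/
theorem le_add_inner_gradient_add_of_gradient_lipschitz
    {E : Type*} [NormedAddCommGroup E] [InnerProductSpace ℝ E] [CompleteSpace E]
    {f : E → ℝ} {L : ℝ} (hf : Differentiable ℝ f)
    (hL : ∀ x y, ‖gradient f x - gradient f y‖ ≤ L * ‖x - y‖) (x v : E) :
    f (x + v) ≤ f x + inner ℝ (gradient f x) v + L / 2 * ‖v‖ ^ 2 := by
  have hder (t : ℝ) : HasDerivAt
      (fun t : ℝ ↦ f (x + t • v) - t * inner ℝ (gradient f x) v - L / 2 * ‖v‖ ^ 2 * t ^ 2)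
      (inner ℝ (gradient f (x + t • v)) v - inner ℝ (gradient f x) v
        - L * ‖v‖ ^ 2 * t) t := by
    have hline : HasDerivAt (fun t : ℝ ↦ x + t • v) v t := by
      simpa using ((hasDerivAt_id t).smul_const v).const_add x
    have hcomp := (hf (x + t • v)).hasGradientAt.hasFDerivAt.comp_hasDerivAt t hline
    rw [InnerProductSpace.toDual_apply_apply] at hcomp
    refine HasDerivAt.congr_deriv
      ((hcomp.sub ((hasDerivAt_id t).mul_const (inner ℝ (gradient f x) v))).sub
        ((hasDerivAt_pow 2 t).const_mul (L / 2 * ‖v‖ ^ 2))) ?_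
    push_cast
    ring
  have hanti := antitoneOn_of_deriv_nonpos (convex_Ici (0 : ℝ))
    (fun t _ ↦ (hder t).continuousAt.continuousWithinAt)
    (fun t _ ↦ (hder t).differentiableAt.differentiableWithinAt)
    (fun t ht ↦ by
      rw [interior_Ici, Set.mem_Ioi] at ht
      rw [(hder t).deriv, ← inner_sub_left, sub_nonpos]
      calc inner ℝ (gradient f (x + t • v) - gradient f x) v
          ≤ ‖gradient f (x + t • v) - gradient f x‖ * ‖v‖ := real_inner_le_norm _ _
        _ ≤ L * ‖x + t • v - x‖ * ‖v‖ := by gcongr; exact hL _ _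
        _ = L * ‖v‖ ^ 2 * t := by
          rw [add_sub_cancel_left, norm_smul, Real.norm_of_nonneg ht.le]
          ring)
  have h01 := hanti (Set.mem_Ici.2 le_rfl) (Set.mem_Ici.2 zero_le_one) zero_le_one
  simp only [one_smul, zero_smul, add_zero] at h01
  linarith

/-- **Descent Lemma.** For `ℒ : ℝ^p → ℝ` differentiable with `L`-Lipschitz
gradient, a diagonal preconditioner `D = diag(d)` with `dᵢ ≥ α > 0`, step size `γ > 0`, and
the preconditioned update `W' = W − γ D⁻¹ m`:
`ℒ(W') ≤ ℒ(W) + (γ/(2α))‖∇ℒ(W) − m‖² − (1/(2γ) − L/(2α))‖W' − W‖²_D − (γ/2)‖∇ℒ(W)‖²_{D⁻¹}`,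
where `‖v‖²_M = ⟨v, M v⟩` (so `‖v‖²_D = Σᵢ dᵢ vᵢ²` and `‖v‖²_{D⁻¹} = Σᵢ vᵢ²/dᵢ`). -/
theorem descent_lemma_preconditioned
    (p : ℕ) (L α γ : ℝ)
    (hα : 0 < α) (hγ : 0 < γ)
    (ℒ : EuclideanSpace ℝ (Fin p) → ℝ)
    (hdiff : Differentiable ℝ ℒ)
    (hLip : ∀ x y : EuclideanSpace ℝ (Fin p),
      ‖gradient ℒ x - gradient ℒ y‖ ≤ L * ‖x - y‖)
    (d : Fin p → ℝ) (hd : ∀ i, α ≤ d i)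
    (m W W' : EuclideanSpace ℝ (Fin p))
    (hW' : ∀ i, W' i = W i - γ * (m i / d i)) :
    ℒ W' ≤ ℒ W + (γ / (2 * α)) * ‖gradient ℒ W - m‖ ^ 2
      - (1 / (2 * γ) - L / (2 * α)) * (∑ i, d i * (W' i - W i) ^ 2)
      - (γ / 2) * (∑ i, (gradient ℒ W i) ^ 2 / d i) := by
  have hd_pos (i : Fin p) : 0 < d i := hα.trans_le (hd i)
  have hquad := le_add_inner_gradient_add_of_gradient_lipschitz hdiff hLip W (W' - W)
  rw [add_sub_cancel] at hquad
  have hnorm (v : EuclideanSpace ℝ (Fin p)) : ‖v‖ ^ 2 = ∑ i, v i ^ 2 :=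
    EuclideanSpace.real_norm_sq_eq v
  have hcurv : L / 2 * ‖W' - W‖ ^ 2 ≤ L / (2 * α) * ∑ i, d i * (W' i - W i) ^ 2 := by
    rcases eq_or_ne W' W with rfl | hne
    · simp
    have hL : 0 ≤ L := nonneg_of_mul_nonneg_left
      ((norm_nonneg _).trans (hLip W' W)) (norm_pos_iff.2 (sub_ne_zero.2 hne))
    calc L / 2 * ‖W' - W‖ ^ 2 = L / (2 * α) * ∑ i, α * (W' i - W i) ^ 2 := by
          rw [hnorm, ← Finset.mul_sum]
          simp only [PiLp.sub_apply]
          field_simp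
      _ ≤ L / (2 * α) * ∑ i, d i * (W' i - W i) ^ 2 := by
          gcongr with i
          exact hd i
  have hinner : inner ℝ (gradient ℒ W) (W' - W) ≤ γ / (2 * α) * ‖gradient ℒ W - m‖ ^ 2
      - 1 / (2 * γ) * (∑ i, d i * (W' i - W i) ^ 2)
      - γ / 2 * (∑ i, (gradient ℒ W i) ^ 2 / d i) := by
    rw [hnorm, PiLp.inner_apply, Finset.mul_sum, Finset.mul_sum, Finset.mul_sum,
      ← Finset.sum_sub_distrib, ← Finset.sum_sub_distrib]
    refine Finset.sum_le_sum fun i _ ↦ ?_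
    have hdi := hd_pos i
    have hle : γ / (2 * d i) * (gradient ℒ W i - m i) ^ 2
        ≤ γ / (2 * α) * (gradient ℒ W i - m i) ^ 2 := by
      gcongr
      exact hd i
    have heq : (W' i - W i) * gradient ℒ W i = γ / (2 * d i) * (gradient ℒ W i - m i) ^ 2
        - 1 / (2 * γ) * (d i * (W' i - W i) ^ 2) - γ / 2 * (gradient ℒ W i ^ 2 / d i) := by
      rw [hW' i]
      field_simp
      ring
    simp only [PiLp.sub_apply, RCLike.inner_apply, conj_trivial]
    linarith
  linarith
end
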